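/- Let ν = p_1^{a_1} ··· p_l^{a_l} be the prime factorization of ν. If there exists a tuple (z_1,...,z_μ) of ν-th roots of unity with μ ≥ 1 and z_1 + ... + z_μ = 0, then μ lies in the additive monoid generated by p_1,...,p_l, i.e., μ = c_1 p_1 + ... + c_l p_l for some nonnegative integers c_i (the 'only if' direction of the Lam–Leung theorem). -/

import Mathlib

lemma comb (r p q : ℕ) (M : AddSubmonoid ℕ) (hrM : r ∈ M) (hqr : q ≤ r) (hpq : p < q)
    (k l : Fin r → ℕ) (hk : ∑ j, k j < p) (i : Fin r) (hmin : ∀ t, k t = 0 → l i ≤ l t)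
    (h : ∀ j, k j + l i < p →
      (∃ c ∈ M, l j = k j + l i + c) ∨ (p - (k j + l i)) * (q - 1) ≤ l j) :
    (∃ c ∈ M, ∑ j, l j = ∑ j, k j + c) ∨ (p - ∑ j, k j) * (q - 1) ≤ ∑ j, l j := by
  classical
  by_cases hall : ∀ j, ∃ c ∈ M, l j = k j + l i + c
  · left
    choose c hc hl using hall
    refine ⟨r * l i + ∑ j, c j, M.add_mem ?_ (M.sum_mem fun j _ => hc j), ?_⟩
    · rw [mul_comm, ← smul_eq_mul]; exact M.nsmul_mem hrM _
    · rw [Finset.sum_congr rfl fun j _ => hl j, Finset.sum_add_distrib, Finset.sum_add_distrib]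
      simp [add_assoc]
  · right
    push Not at hall
    obtain ⟨j, hj⟩ := hall
    have hj2 : ((p : ℤ) - (k j + l i)) * (q - 1) ≤ l j := by
      by_cases hlt : k j + l i < p
      · rcases h j hlt with ⟨c, hc, e⟩ | h2
        · exact absurd e (hj c hc)
        · zify [hlt.le, (by omega : 1 ≤ q)] at h2
          exact h2
      · have : ((p : ℤ) - (k j + l i)) ≤ 0 := by omega
        have : (0:ℤ) ≤ q - 1 := by omega
        nlinarith
    have hb : ∀ t, (l i : ℤ) - k t * l i ≤ l t := by
      intro t
      rcases Nat.eq_zero_or_pos (k t) with h0 | h0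
      · have := hmin t h0
        rw [h0]; simp; omega
      · have : (1 : ℤ) ≤ k t := by exact_mod_cast h0
        nlinarith [(l i).cast_nonneg (α := ℤ), (l t).cast_nonneg (α := ℤ)]
    have hkj : k j ≤ ∑ j, k j := Finset.single_le_sum (f := k) (fun _ _ => Nat.zero_le _) (Finset.mem_univ j)
    have tot : ∑ t, ((l i : ℤ) - k t * l i) = (r - (∑ t, k t : ℕ)) * l i := by
      rw [Finset.sum_sub_distrib, ← Finset.sum_mul]; simp; ring
    zify [hk.le, (by omega : 1 ≤ q)]
    have e1 := Finset.add_sum_erase Finset.univ (fun t => (l t : ℤ)) (Finset.mem_univ j)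
    have e2 := Finset.add_sum_erase Finset.univ (fun t => ((l i : ℤ) - k t * l i)) (Finset.mem_univ j)
    have le1 : ∑ t ∈ Finset.univ.erase j, ((l i : ℤ) - k t * l i) ≤ ∑ t ∈ Finset.univ.erase j, (l t : ℤ) :=
      Finset.sum_le_sum fun t _ => hb t
    have le2 : ∑ t, ((l i : ℤ) - k t * l i) ≤ ∑ t, (l t : ℤ) := Finset.sum_le_sum fun t _ => hb t
    rw [tot] at e2 le2
    rw [← Nat.cast_sum Finset.univ k]
    generalize (∑ t, k t) = K at *
    generalize (∑ t, (l t : ℤ)) = L at *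
    have hli : (0 : ℤ) ≤ l i := by positivity
    generalize (l i : ℤ) = a at *
    zify at hqr hpq hk hkj
    by_cases haq : a ≤ q - 1
    · have h1 : 0 ≤ ((K : ℤ) - k j) * (q - 1 - a) := mul_nonneg (by linarith) (by linarith)
      have h2 : 0 ≤ ((r : ℤ) - q) * a := mul_nonneg (by linarith) hli
      nlinarith
    · have h1 : ((q : ℤ) - K) * q ≤ (r - K) * a := mul_le_mul (by linarith) (by linarith) (by positivity) (by linarith)
      have h2 : ((p : ℤ) - K) * (q - 1) ≤ (q - K) * q := mul_le_mul (by linarith) (by linarith) (by linarith) (by linarith)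
      linarith

lemma decomp (r m n : ℕ) (ω : ℂ) (hω : ∀ z : ℂ, z ^ n = 1 → ∃ j : Fin r, ∃ w : ℂ, w ^ m = 1 ∧ z = ω ^ (j : ℕ) * w)
    (x : Multiset ℂ) (hx : ∀ z ∈ x, z ^ n = 1) :
    ∃ X : Fin r → Multiset ℂ, (∀ j, ∀ z ∈ X j, z ^ m = 1) ∧
      x.sum = ∑ j : Fin r, ω ^ (j : ℕ) * (X j).sum ∧ x.card = ∑ j, (X j).card := by
  classical
  induction x using Multiset.induction with
  | empty => exact ⟨fun _ => 0, by simp, by simp, by simp⟩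
  | cons a s ih =>
    obtain ⟨X, h1, h2, h3⟩ := ih fun z hz => hx z (Multiset.mem_cons_of_mem hz)
    obtain ⟨j, w, hw, e⟩ := hω a (hx a (Multiset.mem_cons_self a s))
    refine ⟨fun t => X t + if t = j then {w} else 0, ?_, ?_, ?_⟩
    · intro t z hz
      rw [Multiset.mem_add] at hz
      rcases hz with hz | hz
      · exact h1 t z hz
      · split_ifs at hz
        · simp at hz; rw [hz, hw]
        · simp at hz
    · simp only [Multiset.sum_cons, Multiset.sum_add, mul_add, Finset.sum_add_distrib, h2, apply_ite Multiset.sum, e]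
      simp [add_comm]
    · simp only [Multiset.card_cons, Multiset.card_add, Finset.sum_add_distrib, h3, apply_ite Multiset.card]
      simp

open IntermediateField in
lemma degree_gen {F E : Type*} [Field F] [Field E] [Algebra F E] (a ω ζ : E)
    (ha : IsIntegral F a) (hω : IsIntegral F ω) (hmem : ζ ∈ F⟮a, ω⟯) :
    Module.finrank F F⟮ζ⟯ ≤ Module.finrank F F⟮a⟯ * (minpoly F⟮a⟯ ω).natDegree := by
  have hωi : IsIntegral F⟮a⟯ ω := hω.tower_top
  have : FiniteDimensional F F⟮a⟯ := adjoin.finiteDimensional ha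
  have : FiniteDimensional F⟮a⟯ F⟮a⟯⟮ω⟯ := adjoin.finiteDimensional hωi
  have : Module.Free F⟮a⟯ F⟮a⟯⟮ω⟯ := Module.Free.of_divisionRing _ _
  have e := Module.finrank_mul_finrank F F⟮a⟯ F⟮a⟯⟮ω⟯
  rw [adjoin.finrank hωi] at e
  rw [e]
  have hle : F⟮ζ⟯ ≤ (F⟮a⟯⟮ω⟯).restrictScalars F := by
    rw [adjoin_simple_adjoin_simple]
    exact adjoin_simple_le_iff.mpr hmem
  have : FiniteDimensional F F⟮a⟯⟮ω⟯ := Module.Finite.trans F⟮a⟯ _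
  exact LinearMap.finrank_le_finrank_of_injective (f := (IntermediateField.inclusion hle).toLinearMap) (IntermediateField.inclusion hle).injective

open IntermediateField in
lemma degree_bound (m n : ℕ) (hm : 0 < m) (hn : 0 < n) (a ω ζ : ℂ) (ha : IsPrimitiveRoot a m) (hζ : IsPrimitiveRoot ζ n)
    (hint : ω ^ n = 1)
    (hmem : ζ ∈ ℚ⟮a, ω⟯) : n.totient ≤ m.totient * (minpoly ℚ⟮a⟯ ω).natDegree := by
  have key : ∀ (b : ℂ) (d : ℕ), 0 < d → IsPrimitiveRoot b d → Module.finrank ℚ ℚ⟮b⟯ = d.totient := by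
    intro b d hd hb
    rw [adjoin.finrank ((hb.isIntegral hd).tower_top), ← Polynomial.cyclotomic_eq_minpoly_rat hb hd, Polynomial.natDegree_cyclotomic]
  rw [← key a m hm ha, ← key ζ n hn hζ]
  exact degree_gen a ω ζ (ha.isIntegral hm).tower_top (IsIntegral.of_pow hn (by rw [hint]; exact isIntegral_one)) hmem

open IntermediateField Polynomial in
lemma indepA (r : ℕ) (ω : ℂ) (K : IntermediateField ℚ ℂ) 
   (hd : r ≤ (minpoly K ω).natDegree) (b : Fin r → ℂ) (hb : ∀ j, b j ∈ K)
   (h : ∑ j : Fin r, ω ^ (j : ℕ) * b j = 0) : ∀ j, b j = 0 := by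
  set P : K[X] := ∑ j : Fin r, C ⟨b j, hb j⟩ * X ^ (j : ℕ) with hP
  have hdeg : P.degree < r := by
    refine lt_of_le_of_lt (degree_sum_le _ _) ?_
    rw [Finset.sup_lt_iff (WithBot.bot_lt_coe _)]
    intro j _
    exact lt_of_le_of_lt (degree_C_mul_X_pow_le _ _) (by exact_mod_cast j.2)
  have hroot : aeval ω P = 0 := by
    rw [hP, map_sum, ← h]
    refine Finset.sum_congr rfl fun j _ => ?_
    rw [map_mul, aeval_C, map_pow, aeval_X, mul_comm]
    rfl
  have h0 : P = 0 := by
    by_contra hne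
    have := Polynomial.natDegree_le_of_dvd (minpoly.dvd K ω hroot) hne
    rw [← natDegree_lt_iff_degree_lt hne] at hdeg
    omega
  intro j
  have : P.coeff j = ⟨b j, hb j⟩ := by
    rw [hP, finsetSum_coeff]
    simp [coeff_C_mul, coeff_X_pow, Fin.val_inj]
  rw [h0] at this
  simpa using (congrArg Subtype.val this).symm

lemma indepB (r : ℕ) (hr : 1 < r) (ω : ℂ) (K : IntermediateField ℚ ℂ) (hω : ∑ j : Fin r, ω ^ (j : ℕ) = 0)
   (hd : r - 1 ≤ (minpoly K ω).natDegree) (b : Fin r → ℂ) (hb : ∀ j, b j ∈ K)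
   (h : ∑ j : Fin r, ω ^ (j : ℕ) * b j = 0) : ∀ i j, b i = b j := by
  obtain ⟨s, rfl⟩ : ∃ s, r = s + 1 := ⟨r - 1, by omega⟩
  have := indepA s ω K (by simpa using hd) (fun j => b j.castSucc - b (Fin.last s)) (fun j => sub_mem (hb _) (hb _)) (by
    have : ∑ j : Fin (s+1), ω ^ (j : ℕ) * (b j - b (Fin.last s)) = 0 := by
      simp_rw [mul_sub, Finset.sum_sub_distrib, ← Finset.sum_mul, hω, h]; simp
    rw [Fin.sum_univ_castSucc] at this
    simpa using this)
  have h2 : ∀ i, b i = b (Fin.last s) := by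
    intro i
    induction i using Fin.lastCases with
    | last => rfl
    | cast j => exact sub_eq_zero.mp (this j)
  intro i j; rw [h2 i, h2 j]

open IntermediateField in
lemma structA (r m : ℕ) (hr : r.Prime) (hm : 0 < m) (hrm : r ∣ m) : ∃ ω : ℂ,
    (∀ z : ℂ, z ^ (r * m) = 1 → ∃ j : Fin r, ∃ w : ℂ, w ^ m = 1 ∧ z = ω ^ (j : ℕ) * w) ∧
    ∃ K : IntermediateField ℚ ℂ, (∀ w : ℂ, w ^ m = 1 → w ∈ K) ∧ r ≤ (minpoly K ω).natDegree := by
  have hn : 0 < r * m := Nat.mul_pos hr.pos hm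
  have : NeZero (r * m) := ⟨hn.ne'⟩
  have : NeZero m := ⟨hm.ne'⟩
  have hζ := Complex.isPrimitiveRoot_exp (r * m) hn.ne'
  set ζ := Complex.exp (2 * Real.pi * Complex.I / ((r * m : ℕ) : ℂ))
  have ha : IsPrimitiveRoot (ζ ^ r) m := hζ.pow hn rfl
  refine ⟨ζ, ?_, ℚ⟮ζ ^ r⟯, ?_, ?_⟩
  · intro z hz
    obtain ⟨i, _, rfl⟩ := hζ.eq_pow_of_pow_eq_one hz
    refine ⟨⟨i % r, Nat.mod_lt _ hr.pos⟩, (ζ ^ r) ^ (i / r), ?_, ?_⟩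
    · rw [← pow_mul, mul_comm, pow_mul, ha.pow_eq_one, one_pow]
    · rw [← pow_mul, ← pow_add, Nat.mod_add_div]
  · intro w hw
    obtain ⟨i, _, rfl⟩ := ha.eq_pow_of_pow_eq_one hw
    exact pow_mem (mem_adjoin_simple_self _ _) _
  · have := degree_bound m (r * m) hm hn (ζ ^ r) ζ ζ ha hζ hζ.pow_eq_one (subset_adjoin _ _ (by simp))
    rw [Nat.totient_mul_of_prime_of_dvd hr hrm, mul_comm] at this
    exact Nat.le_of_mul_le_mul_left this (Nat.totient_pos.mpr hm)

open IntermediateField in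
lemma structB (r m : ℕ) (hr : r.Prime) (hm : 0 < m) (hrm : ¬ r ∣ m) : ∃ ω : ℂ,
    (∀ z : ℂ, z ^ (r * m) = 1 → ∃ j : Fin r, ∃ w : ℂ, w ^ m = 1 ∧ z = ω ^ (j : ℕ) * w) ∧
    ∑ j : Fin r, ω ^ (j : ℕ) = 0 ∧
    ∃ K : IntermediateField ℚ ℂ, (∀ w : ℂ, w ^ m = 1 → w ∈ K) ∧ r - 1 ≤ (minpoly K ω).natDegree := by
  have hn : 0 < r * m := Nat.mul_pos hr.pos hm
  have : NeZero (r * m) := ⟨hn.ne'⟩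
  have : NeZero m := ⟨hm.ne'⟩
  have : NeZero r := ⟨hr.ne_zero⟩
  have hζ := Complex.isPrimitiveRoot_exp (r * m) hn.ne'
  set ζ := Complex.exp (2 * Real.pi * Complex.I / ((r * m : ℕ) : ℂ))
  have hζ0 : ζ ≠ 0 := hζ.ne_zero hn.ne'
  have ha : IsPrimitiveRoot (ζ ^ r) m := hζ.pow hn rfl
  have hω : IsPrimitiveRoot (ζ ^ m) r := hζ.pow hn (mul_comm _ _)
  have hcop : Nat.Coprime r m := (Nat.Prime.coprime_iff_not_dvd hr).mpr hrm
  have hbez : ζ = (ζ ^ r) ^ (Nat.gcdA r m) * (ζ ^ m) ^ (Nat.gcdB r m) := by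
    have h := Nat.gcd_eq_gcd_ab r m
    rw [hcop.gcd_eq_one] at h
    rw [← zpow_natCast, ← zpow_natCast, ← zpow_mul, ← zpow_mul, ← zpow_add₀ hζ0, ← h]
    simp
  have hpz : ∀ (u : ℂ) (d : ℕ), u ^ d = 1 → ∀ (g : ℤ) (i : ℕ), ((u ^ g) ^ i) ^ d = 1 := by
    intro u d hu g i
    rw [← pow_mul, mul_comm, pow_mul, ← zpow_natCast (u ^ g), ← zpow_mul, mul_comm, zpow_mul, zpow_natCast, hu, one_zpow, one_pow]
  refine ⟨ζ ^ m, ?_, ?_, ℚ⟮ζ ^ r⟯, ?_, ?_⟩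
  · intro z hz
    obtain ⟨i, _, rfl⟩ := hζ.eq_pow_of_pow_eq_one hz
    obtain ⟨j, hj, e⟩ := hω.eq_pow_of_pow_eq_one (ξ := ((ζ ^ m) ^ (Nat.gcdB r m)) ^ i) (by
      exact hpz _ _ hω.pow_eq_one _ _)
    refine ⟨⟨j, hj⟩, ((ζ ^ r) ^ (Nat.gcdA r m)) ^ i, ?_, ?_⟩
    · exact hpz _ _ ha.pow_eq_one _ _
    · simp only [e]
      rw [← mul_pow, mul_comm, ← hbez]
  · rw [Fin.sum_univ_eq_sum_range (fun j => (ζ ^ m) ^ j)]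
    exact hω.geom_sum_eq_zero hr.one_lt
  · intro w hw
    obtain ⟨i, _, rfl⟩ := ha.eq_pow_of_pow_eq_one hw
    exact pow_mem (mem_adjoin_simple_self _ _) _
  · have := degree_bound m (r * m) hm hn (ζ ^ r) (ζ ^ m) ζ ha hζ (by rw [← pow_mul, mul_comm, pow_mul, hζ.pow_eq_one, one_pow]) (by
      have h1 : ζ ^ r ∈ ℚ⟮ζ ^ r, ζ ^ m⟯ := subset_adjoin _ _ (by simp)
      have h2 : ζ ^ m ∈ ℚ⟮ζ ^ r, ζ ^ m⟯ := subset_adjoin _ _ (by simp)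
      have h3 := mul_mem (zpow_mem h1 (Nat.gcdA r m)) (zpow_mem h2 (Nat.gcdB r m))
      rwa [← hbez] at h3)
    rw [Nat.totient_mul hcop, mul_comm, Nat.totient_prime hr] at this
    exact Nat.le_of_mul_le_mul_left this (Nat.totient_pos.mpr hm)

abbrev MM (n : ℕ) : AddSubmonoid ℕ := AddSubmonoid.closure (n.primeFactors : Set ℕ)

lemma exists_max_prime (n : ℕ) (hn : 1 < n) : ∃ r, r.Prime ∧ r ∣ n ∧ ∀ s, s.Prime → s ∣ n → s ≤ r := by
  have hne : n.primeFactors.Nonempty := Nat.nonempty_primeFactors.mpr hn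
  have h := Finset.max'_mem _ hne
  refine ⟨n.primeFactors.max' hne, Nat.prime_of_mem_primeFactors h, Nat.dvd_of_mem_primeFactors h, fun s hs hd => ?_⟩
  exact Finset.le_max' _ _ (Nat.mem_primeFactors.mpr ⟨hs, hd, by omega⟩)

lemma sum_one (x : Multiset ℂ) (hx : ∀ z ∈ x, z ^ 1 = 1) : x.sum = x.card := by
  have h : x = Multiset.replicate x.card 1 :=
    Multiset.eq_replicate_card.mpr (fun z hz => by simpa using hx z hz)
  have h2 := congrArg Multiset.sum h
  simpa using h2

lemma key (p q : ℕ) (hpq : p < q) (n : ℕ) (hn : 0 < n)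
    (hpr : ∀ r, r.Prime → r ∣ n → r = p ∨ q ≤ r) (x y : Multiset ℂ)
    (hx : ∀ z ∈ x, z ^ n = 1) (hy : ∀ z ∈ y, z ^ n = 1) (hxy : x.sum = y.sum) (hc : x.card < p) :
    (∃ c ∈ MM n, y.card = x.card + c) ∨ (p - x.card) * (q - 1) ≤ y.card := by
  induction n using Nat.strong_induction_on generalizing x y with
  | _ n IH =>
  rcases Nat.eq_or_lt_of_le (Nat.succ_le_of_lt hn) with h1 | h1
  · obtain rfl : n = 1 := by omega
    rw [sum_one x hx, sum_one y hy] at hxy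
    exact Or.inl ⟨0, zero_mem _, by exact_mod_cast hxy.symm⟩
  obtain ⟨r, hr, ⟨m, rfl⟩, hmax⟩ := exists_max_prime n h1
  have hm : 0 < m := Nat.pos_of_mul_pos_left hn
  have hmn : m < r * m := by nlinarith [hr.one_lt]
  have hMM : MM m ≤ MM (r * m) := AddSubmonoid.closure_mono (by
    exact_mod_cast Nat.primeFactors_mono (Dvd.intro_left r rfl) hn.ne')
  have hrM : r ∈ MM (r * m) := AddSubmonoid.subset_closure (by
    simpa using ⟨hr, hr.ne_zero, hm.ne'⟩)
  have IH' := IH m hmn hm (fun s hs hd => hpr s hs (Dvd.dvd.mul_left hd r))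
  by_cases hrm : r ∣ m
  · obtain ⟨ω, hω, K, hK, hd⟩ := structA r m hr hm hrm
    obtain ⟨X, hX, hXs, hXc⟩ := decomp r m _ ω hω x hx
    obtain ⟨Y, hY, hYs, hYc⟩ := decomp r m _ ω hω y hy
    have hv := indepA r ω K hd (fun j => (X j).sum - (Y j).sum)
      (fun j => sub_mem (multiset_sum_mem _ fun z hz => hK z (hX j z hz)) (multiset_sum_mem _ fun z hz => hK z (hY j z hz)))
      (by simp_rw [mul_sub, Finset.sum_sub_distrib]; rw [← hXs, ← hYs, hxy, sub_self])
    have hle : ∀ j, (X j).card ≤ x.card := fun j => by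
      rw [hXc]; exact Finset.single_le_sum (f := fun j => (X j).card) (fun _ _ => Nat.zero_le _) (Finset.mem_univ j)
    have hall := fun j => IH' (X j) (Y j) (hX j) (hY j) (sub_eq_zero.mp (hv j)) (lt_of_le_of_lt (hle j) hc)
    by_cases hg : ∀ j, ∃ c ∈ MM m, (Y j).card = (X j).card + c
    · left
      choose c hc hl using hg
      refine ⟨∑ j, c j, sum_mem fun j _ => hMM (hc j), ?_⟩
      rw [hXc, hYc, ← Finset.sum_add_distrib]
      exact Finset.sum_congr rfl fun j _ => hl j
    · right
      rw [not_forall] at hg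
      obtain ⟨j, hj⟩ := hg
      have := (hall j).resolve_left hj
      calc _ ≤ (p - (X j).card) * (q - 1) := Nat.mul_le_mul_right _ (Nat.sub_le_sub_left (hle j) p)
        _ ≤ _ := this
        _ ≤ _ := by
          rw [hYc]; exact Finset.single_le_sum (f := fun j => (Y j).card) (fun _ _ => Nat.zero_le _) (Finset.mem_univ j)
  · obtain ⟨ω, hω, hω0, K, hK, hd⟩ := structB r m hr hm hrm
    obtain ⟨X, hX, hXs, hXc⟩ := decomp r m _ ω hω x hx
    obtain ⟨Y, hY, hYs, hYc⟩ := decomp r m _ ω hω y hy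
    have hv := indepB r hr.one_lt ω K hω0 hd (fun j => (X j).sum - (Y j).sum)
      (fun j => sub_mem (multiset_sum_mem _ fun z hz => hK z (hX j z hz)) (multiset_sum_mem _ fun z hz => hK z (hY j z hz)))
      (by simp_rw [mul_sub, Finset.sum_sub_distrib]; rw [← hXs, ← hYs, hxy, sub_self])
    have hrp : p ≤ r := by rcases hpr r hr (Dvd.intro _ rfl) with h | h <;> omega
    obtain ⟨i0, hi0⟩ : ∃ i, (X i).card = 0 := by
      by_contra hne
      push Not at hne
      have : ∑ j : Fin r, 1 ≤ ∑ j, (X j).card := Finset.sum_le_sum fun j _ => Nat.one_le_iff_ne_zero.mpr (hne j)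
      simp at this
      omega
    obtain ⟨i, hi, hmin⟩ := Finset.exists_min_image (Finset.univ.filter fun i => (X i).card = 0) (fun i => (Y i).card) ⟨i0, Finset.mem_filter.mpr ⟨Finset.mem_univ _, hi0⟩⟩
    simp only [Finset.mem_filter, Finset.mem_univ, true_and] at hi hmin
    have hXi : X i = 0 := Multiset.card_eq_zero.mp hi
    have hval : ∀ j, (X j + Y i).sum = (Y j).sum := by
      intro j
      have := hv i j
      simp only [hXi, Multiset.sum_zero] at this
      rw [Multiset.sum_add]
      linear_combination -this
    have hXY : ∀ j, ∀ z ∈ X j + Y i, z ^ m = 1 := by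
      intro j z hz
      rcases Multiset.mem_add.mp hz with h | h
      · exact hX j z h
      · exact hY i z h
    rw [hXc] at hc
    rw [hXc, hYc]
    rcases hpr r hr (Dvd.intro _ rfl) with h | hqr
    · -- here m = 1
      obtain rfl : m = 1 := by
        by_contra hm1
        obtain ⟨s, hs, hsm⟩ := Nat.exists_prime_and_dvd hm1
        have h2 := hmax s hs (Dvd.dvd.mul_left hsm r)
        rcases hpr s hs (Dvd.dvd.mul_left hsm r) with h3 | h3
        · rw [h3, ← h] at hsm; exact hrm hsm
        · omega
      left
      refine ⟨(Y i).card * r, by rw [← smul_eq_mul]; exact nsmul_mem hrM _, ?_⟩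
      have : ∀ j, (Y j).card = (X j).card + (Y i).card := by
        intro j
        have h3 := hval j
        rw [sum_one _ (hXY j), sum_one _ (hY j)] at h3
        rw [← Multiset.card_add]
        exact_mod_cast h3.symm
      rw [Finset.sum_congr rfl fun j _ => this j, Finset.sum_add_distrib]
      simp [mul_comm]
    · refine comb r p q (MM (r * m)) hrM hqr hpq (fun j => (X j).card) (fun j => (Y j).card) hc i hmin ?_
      intro j hj
      rw [← Multiset.card_add] at hj ⊢
      rcases IH' (X j + Y i) (Y j) (hXY j) (hY j) (hval j) hj with ⟨c, hc, e⟩ | h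
      · exact Or.inl ⟨c, hMM hc, e⟩
      · exact Or.inr h

lemma lam_aux (ν : ℕ) (hν : 0 < ν) (y : Multiset ℂ) (hy0 : 1 ≤ y.card)
    (hroots : ∀ z ∈ y, z ^ ν = 1) (hsum : y.sum = 0) : y.card ∈ MM ν := by
  rcases Nat.eq_or_lt_of_le (Nat.succ_le_of_lt hν) with h1 | h1
  · obtain rfl : ν = 1 := by omega
    rw [sum_one y hroots] at hsum
    have : y.card = 0 := by exact_mod_cast hsum
    omega
  have hp : ν.minFac.Prime := Nat.minFac_prime (by omega)
  have hpd := Nat.minFac_dvd ν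
  set p := ν.minFac
  have hpmin : ∀ s, s.Prime → s ∣ ν → p ≤ s := fun s hs hd => Nat.minFac_le_of_dvd hs.two_le hd
  have run : ∀ q, p < q → (∀ r, r.Prime → r ∣ ν → r = p ∨ q ≤ r) → y.card ∈ MM ν ∨ p * (q - 1) ≤ y.card := by
    intro q hpq hq
    rcases key p q hpq ν hν hq 0 y (by simp) hroots (by simp [hsum]) (by simpa using hp.pos) with ⟨c, hc, e⟩ | h
    · left; simp at e; rwa [e]
    · right; simpa using h
  by_cases hex : ∃ q, q.Prime ∧ q ∣ ν ∧ q ≠ p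
  · classical
    have hq := Nat.find_spec hex
    have hqm := fun s => Nat.find_min' hex (m := s)
    set q := Nat.find hex
    have hpq : p < q := lt_of_le_of_ne (hpmin q hq.1 hq.2.1) hq.2.2.symm
    rcases run q hpq (fun r hr hd => or_iff_not_imp_left.mpr fun hne => hqm r ⟨hr, hd, hne⟩) with h | h
    · exact h
    · have hF := (frobeniusNumber_iff.mp (frobeniusNumber_pair ((Nat.coprime_primes hp hq.1).mpr hpq.ne) hp.one_lt hq.1.one_lt)).2 y.card (by
        have := hq.1.two_le
        have := hp.two_le
        rw [Nat.mul_sub, mul_one] at h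
        have : p * 2 ≤ p * q := Nat.mul_le_mul_left _ (by omega)
        omega)
      refine AddSubmonoid.closure_mono ?_ hF
      intro s hs
      simp only [Set.mem_insert_iff, Set.mem_singleton_iff] at hs
      simp only [Finset.mem_coe, Nat.mem_primeFactors]
      rcases hs with rfl | rfl
      · exact ⟨hp, hpd, hν.ne'⟩
      · exact ⟨hq.1, hq.2.1, hν.ne'⟩
  · push Not at hex
    rcases run (p + y.card + 2) (by omega) (fun r hr hd => Or.inl (hex r hr hd)) with h | h
    · exact h
    · have := hp.two_le
      have : 1 * (p + y.card + 2 - 1) ≤ p * (p + y.card + 2 - 1) := Nat.mul_le_mul_right _ (by omega)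
      omega

lemma mem_MM (ν μ : ℕ) (h : μ ∈ MM ν) : ∃ c : ℕ → ℕ, μ = ∑ p ∈ ν.primeFactors, c p * p := by
  induction h using AddSubmonoid.closure_induction with
  | mem s hs =>
    refine ⟨fun t => if t = s then 1 else 0, ?_⟩
    simp only [ite_mul, one_mul, zero_mul, Finset.sum_ite_eq']
    rw [if_pos (by exact_mod_cast hs)]
  | zero => exact ⟨0, by simp⟩
  | add a b _ _ ha hb =>
    obtain ⟨c, hc⟩ := ha
    obtain ⟨d, hd⟩ := hb
    refine ⟨c + d, ?_⟩
    simp only [Pi.add_apply, add_mul, Finset.sum_add_distrib]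
    rw [← hc, ← hd]

theorem lam_leung_only_if (ν : ℕ) (hν : 0 < ν) (μ : ℕ) (hμ : 1 ≤ μ)
    (z : Fin μ → ℂ) (hroots : ∀ i, z i ^ ν = 1) (hsum : ∑ i, z i = 0) :
    ∃ c : ℕ → ℕ, μ = ∑ p ∈ ν.primeFactors, c p * p := by
  have h := lam_aux ν hν (Finset.univ.val.map z) (by simpa using hμ)
    (by simpa using hroots) hsum
  simp only [Multiset.card_map, Finset.card_val, Finset.card_univ, Fintype.card_fin] at h
  exact mem_MM ν μ h
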